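/- Let (X,d) be a compact metric space and F : X → 2^X an open, expansive, upper semicontinuous set-valued map with nonempty compact values having the shadowing property. Then the single-valued system (Orb_r(X), σ_rF) is topologically stable. -/

import Mathlib

open Metric Set

variable {X : Type*} [MetricSpace X]

/-- A set-valued map `F : X → 2^X` is *upper semicontinuous* if for every `x` and every open
`U ⊇ F x` there is an open neighborhood `V` of `x` with `F y ⊆ U` for all `y ∈ V`. -/
def SVUpperSC (F : X → Set X) : Prop :=
  ∀ x : X, ∀ U : Set X, IsOpen U → F x ⊆ U →
    ∃ V : Set X, IsOpen V ∧ x ∈ V ∧ ∀ y ∈ V, F y ⊆ U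

/-- A set-valued map is *lower semicontinuous* if for every `x` and every open `U` meeting
`F x` there is an open neighborhood `V` of `x` with `F y ∩ U ≠ ∅` for all `y ∈ V`. -/
def SVLowerSC (F : X → Set X) : Prop :=
  ∀ x : X, ∀ U : Set X, IsOpen U → (F x ∩ U).Nonempty →
    ∃ V : Set X, IsOpen V ∧ x ∈ V ∧ ∀ y ∈ V, (F y ∩ U).Nonempty

/-- A set-valued map is *continuous* if it is both upper and lower semicontinuous. -/
def SVContinuous (F : X → Set X) : Prop := SVUpperSC F ∧ SVLowerSC F

/-- `F` has nonempty compact values. -/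
def SVCompactValued (F : X → Set X) : Prop := ∀ x : X, (F x).Nonempty ∧ IsCompact (F x)

/-- Image of a set under a set-valued map: `F(U) = ⋃_{x ∈ U} F x`. -/
def SVImage (F : X → Set X) (U : Set X) : Set X := ⋃ x ∈ U, F x

/-- A set-valued map is *open* if it maps open sets to open sets. -/
def SVOpen (F : X → Set X) : Prop := ∀ U : Set X, IsOpen U → IsOpen (SVImage F U)

/-- A set-valued map is *onto* if every point lies in some value. -/
def SVOnto (F : X → Set X) : Prop := ∀ y : X, ∃ x : X, y ∈ F x

/-- The inverse set-valued map `F⁻¹(x) = {z : x ∈ F z}`. -/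
def SVInv (F : X → Set X) : X → Set X := fun x => {z | x ∈ F z}

/-- The orbit space `Orb_r(X) = {(x_n) : x_{n+1} ∈ F(x_n)}`. -/
def OrbR (F : X → Set X) : Set (ℕ → X) := {u | ∀ n : ℕ, u (n + 1) ∈ F (u n)}

/-- The left orbit space `Orb_l(X) = {(…,x_{-1},x_0) : x_i ∈ F(x_{i+1})}`, encoded by
`u n = x_{-n}`, so the defining condition reads `u (n+1) ∈ F (u n)`. -/
def OrbL (F : X → Set X) : Set (ℕ → X) := {u | ∀ n : ℕ, u (n + 1) ∈ F (u n)}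

/-- The inverse orbit space `Orb_inv(X) = {(x_n) : x_n ∈ F(x_{n+1})}`. -/
def OrbInv (F : X → Set X) : Set (ℕ → X) := {u | ∀ n : ℕ, u n ∈ F (u (n + 1))}

/-- The shift on sequences. -/
def shiftSeq (u : ℕ → X) : ℕ → X := fun n => u (n + 1)

/-- The shift map `σ_rF : Orb_r(X) → Orb_r(X)`, `(x_n) ↦ (x_{n+1})`. -/
def sigmaR (F : X → Set X) : OrbR F → OrbR F :=
  fun u => ⟨shiftSeq u.1, fun n => u.2 (n + 1)⟩

/-- The shift map `σ_lF : Orb_l(X) → Orb_l(X)`, `(x_{-n}) ↦ (x_{-n-1})`, in the encoding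
`u n = x_{-n}`. -/
def sigmaL (F : X → Set X) : OrbL F → OrbL F :=
  fun u => ⟨shiftSeq u.1, fun n => u.2 (n + 1)⟩

/-- The metric `ρ((x_n),(y_n)) = Σ_{n≥0} d(x_n,y_n)/2^{n+1}` on sequence space. -/
noncomputable def rho (u v : ℕ → X) : ℝ := ∑' n : ℕ, dist (u n) (v n) / 2 ^ (n + 1)

/-- `ρ`-distance from a point to a set of sequences. -/
noncomputable def rhoInf (u : ℕ → X) (B : Set (ℕ → X)) : ℝ := sInf (rho u '' B)

/-- Hausdorff distance with respect to `ρ` between two sets of sequences. -/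
noncomputable def rhoHaus (A B : Set (ℕ → X)) : ℝ :=
  max (sSup ((fun u => rhoInf u B) '' A)) (sSup ((fun v => rhoInf v A) '' B))

/-- The shadowing property for a set-valued map: every `δ`-pseudo-orbit
(`d(x_{n+1}, F(x_n)) < δ`) is `ε`-shadowed by an `F`-orbit. -/
def SVShadowing (F : X → Set X) : Prop :=
  ∀ ε > (0 : ℝ), ∃ δ > (0 : ℝ), ∀ x : ℕ → X,
    (∀ n : ℕ, infDist (x (n + 1)) (F (x n)) < δ) →
    ∃ y : ℕ → X, (∀ n : ℕ, y (n + 1) ∈ F (y n)) ∧ ∀ n : ℕ, dist (x n) (y n) < ε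

/-- The (single-valued) shadowing property for the shift `σ_rF` on `(Orb_r(X), ρ)`. -/
def ShiftShadowingR (F : X → Set X) : Prop :=
  ∀ ε > (0 : ℝ), ∃ δ > (0 : ℝ), ∀ z : ℕ → (ℕ → X),
    (∀ n : ℕ, z n ∈ OrbR F) →
    (∀ n : ℕ, rho (shiftSeq (z n)) (z (n + 1)) < δ) →
    ∃ w ∈ OrbR F, ∀ n : ℕ, rho (shiftSeq^[n] w) (z n) < ε

/-- The (single-valued) shadowing property for the shift `σ_lF` on `(Orb_l(X), ρ)`. -/
def ShiftShadowingL (F : X → Set X) : Prop :=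
  ∀ ε > (0 : ℝ), ∃ δ > (0 : ℝ), ∀ z : ℕ → (ℕ → X),
    (∀ n : ℕ, z n ∈ OrbL F) →
    (∀ n : ℕ, rho (shiftSeq (z n)) (z (n + 1)) < δ) →
    ∃ w ∈ OrbL F, ∀ n : ℕ, rho (shiftSeq^[n] w) (z n) < ε

/-- `F` is expansive with expansive constant `δ`. -/
def SVExpansiveWith (F : X → Set X) (δ : ℝ) : Prop :=
  ∀ u ∈ OrbR F, ∀ v ∈ OrbR F, (∀ n : ℕ, dist (u n) (v n) < δ) → u 0 = v 0

/-- The shift `σ_rF` is expansive (as a single-valued map on `(Orb_r(X), ρ)`)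
with expansive constant `c`. -/
def ShiftExpansiveWith (F : X → Set X) (c : ℝ) : Prop :=
  ∀ u ∈ OrbR F, ∀ v ∈ OrbR F,
    (∀ k : ℕ, rho (shiftSeq^[k] u) (shiftSeq^[k] v) ≤ c) → u = v

/-- The induced set-valued map `F_inv` on `Orb_inv(X)`: `F_inv([x_n]) = F(x_0) × [x_n]`,
i.e. all sequences `(z, x_0, x_1, …)` with `z ∈ F(x_0)`. -/
def Finv (F : X → Set X) (u : ℕ → X) : Set (ℕ → X) :=
  {v | v 0 ∈ F (u 0) ∧ ∀ n : ℕ, v (n + 1) = u n}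

/-- The shadowing property of `F_inv` as a set-valued map on `(Orb_inv(X), ρ)`. -/
def FinvShadowing (F : X → Set X) : Prop :=
  ∀ ε > (0 : ℝ), ∃ δ > (0 : ℝ), ∀ x : ℕ → (ℕ → X),
    (∀ n : ℕ, x n ∈ OrbInv F) →
    (∀ n : ℕ, rhoInf (x (n + 1)) (Finv F (x n)) < δ) →
    ∃ y : ℕ → (ℕ → X), (∀ n : ℕ, y n ∈ OrbInv F) ∧
      (∀ n : ℕ, y (n + 1) ∈ Finv F (y n)) ∧ ∀ n : ℕ, rho (x n) (y n) < ε

/-- Iterates of a set-valued map: `F^0(x) = {x}`, `F^{k+1}(x) = ⋃_{z ∈ F^k(x)} F z`. -/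
def SVIter (F : X → Set X) : ℕ → X → Set X
  | 0 => fun x => {x}
  | n + 1 => fun x => SVImage F (SVIter F n x)

lemma rho_nonneg (u v : ℕ → X) : 0 ≤ rho u v :=
  tsum_nonneg fun n => by positivity

lemma rho_comm (u v : ℕ → X) : rho u v = rho v u := by
  simp only [rho, dist_comm]

section Rho

variable [CompactSpace X]

lemma summable_dist_div_two_pow (u v : ℕ → X) :
    Summable fun n : ℕ => dist (u n) (v n) / 2 ^ (n + 1) := by
  refine Summable.of_nonneg_of_le (fun n => by positivity) (fun n => ?_)
    ((summable_geometric_two' (diam (univ : Set X))))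
  rw [pow_succ', ← div_div]
  have := dist_le_diam_of_mem isCompact_univ.isBounded (mem_univ (u n)) (mem_univ (v n))
  rw [div_div, div_div]
  gcongr

lemma rho_le_diam (u v : ℕ → X) : rho u v ≤ diam (univ : Set X) := by
  rw [← tsum_geometric_two' (diam (univ : Set X))]
  refine (summable_dist_div_two_pow u v).tsum_le_tsum (fun n => ?_) (summable_geometric_two' _)
  have := dist_le_diam_of_mem isCompact_univ.isBounded (mem_univ (u n)) (mem_univ (v n))
  rw [pow_succ', div_div]
  gcongr

lemma rho_eq_dist_zero_add (u v : ℕ → X) :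
    rho u v = dist (u 0) (v 0) / 2 + rho (shiftSeq u) (shiftSeq v) / 2 := by
  unfold rho shiftSeq
  rw [(summable_dist_div_two_pow u v).tsum_eq_zero_add, ← tsum_div_const]
  congr 1
  · simp
  · refine tsum_congr fun n => ?_
    rw [pow_succ _ (n + 1), div_div]

lemma dist_zero_le_two_mul_rho (u v : ℕ → X) : dist (u 0) (v 0) ≤ 2 * rho u v := by
  have := rho_nonneg (shiftSeq u) (shiftSeq v)
  linarith [rho_eq_dist_zero_add u v]

lemma rho_triangle (u v w : ℕ → X) : rho u w ≤ rho u v + rho v w := by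
  unfold rho
  rw [← (summable_dist_div_two_pow u v).tsum_add (summable_dist_div_two_pow v w)]
  refine (summable_dist_div_two_pow u w).tsum_le_tsum (fun n => ?_)
    ((summable_dist_div_two_pow u v).add (summable_dist_div_two_pow v w))
  rw [← add_div]
  gcongr
  exact dist_triangle _ _ _

end Rho

lemma continuous_of_isClosed_setOf_eq {Y Z : Type*} [TopologicalSpace Y] [TopologicalSpace Z]
    [CompactSpace Z] {f : Y → Z} (hf : IsClosed {p : Y × Z | p.2 = f p.1}) : Continuous f := by
  refine continuous_iff_isClosed.2 fun C hC => ?_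
  convert isClosedMap_fst_of_compactSpace _ (hf.inter (hC.preimage continuous_snd)) using 1
  ext y
  simp

lemma SVUpperSC.isClosed_graph {F : X → Set X} (hF : SVUpperSC F) (hFc : SVCompactValued F) :
    IsClosed {p : X × X | p.2 ∈ F p.1} := by
  rw [← isOpen_compl_iff, isOpen_iff_mem_nhds]
  rintro ⟨x, y⟩ hxy
  obtain ⟨U, W, hU, hW, hFU, hyW, hUW⟩ := SeparatedNhds.of_isCompact_isCompact (hFc x).2
    (isCompact_singleton (x := y)) (disjoint_singleton_right.2 hxy)
  obtain ⟨V, hV, hxV, hVU⟩ := hF x U hU hFU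
  filter_upwards [prod_mem_nhds (hV.mem_nhds hxV) (hW.mem_nhds (hyW rfl))]
  rintro ⟨a, b⟩ ⟨ha, hb⟩ hab
  exact disjoint_left.1 hUW (hVU a ha hab) hb

lemma isClosed_orbR {F : X → Set X} (hF : SVUpperSC F) (hFc : SVCompactValued F) :
    IsClosed (OrbR F) := by
  simp only [OrbR, ofPred_forall]
  refine isClosed_iInter fun n => ?_
  exact (hF.isClosed_graph hFc).preimage (f := fun u : ℕ → X => (u n, u (n + 1))) (by fun_prop)

lemma SVExpansiveWith.eq_of_forall_dist_lt {F : X → Set X} {c : ℝ} (hc : SVExpansiveWith F c)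
    {u v : OrbR F} (h : ∀ n, dist (u.1 n) (v.1 n) < c) : u = v := by
  refine Subtype.ext (funext fun n => ?_)
  have := hc (fun m => u.1 (n + m)) (fun m => u.2 (n + m)) (fun m => v.1 (n + m))
    (fun m => v.2 (n + m)) fun m => h (n + m)
  simpa using this

/-- If `F` is an open, expansive, upper semicontinuous set-valued map with
nonempty compact values on a compact metric space and `F` has the shadowing property, then
`(Orb_r(X), σ_rF)` is topologically stable: for every `ε > 0` there is `δ > 0` such that for
every continuous `h : Orb_r(X) → Orb_r(X)` with `sup_z ρ(σ_rF z, h z) < δ` there exists a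
continuous `k : Orb_r(X) → Orb_r(X)` with `sup_z ρ(k z, z) < ε` and `σ_rF ∘ k = k ∘ h`. -/
theorem shift_topologically_stable [CompactSpace X]
    (F : X → Set X) (hopen : SVOpen F) (hexp : ∃ δ > (0 : ℝ), SVExpansiveWith F δ)
    (hF : SVUpperSC F) (hFc : SVCompactValued F) (hsh : SVShadowing F) :
    ∀ ε > (0 : ℝ), ∃ δ > (0 : ℝ), ∀ h : OrbR F → OrbR F, Continuous h →
      (⨆ z : OrbR F, rho (sigmaR F z).1 (h z).1) < δ →
      ∃ k : OrbR F → OrbR F, Continuous k ∧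
        (⨆ z : OrbR F, rho (k z).1 z.1) < ε ∧
        ∀ z : OrbR F, sigmaR F (k z) = k (h z) := by
  intro ε hε
  obtain ⟨c, hc, hexp⟩ := hexp
  obtain ⟨η, hη, hηε, hηc⟩ : ∃ η > 0, η ≤ ε / 4 ∧ η ≤ c / 4 :=
    ⟨min (ε / 4) (c / 4), by positivity, min_le_left _ _, min_le_right _ _⟩
  obtain ⟨δ₀, hδ₀, hsh⟩ := hsh η hη
  refine ⟨min (δ₀ / 2) η, by positivity, fun h hh hsup => ?_⟩
  have hclose : ∀ z, rho (sigmaR F z).1 (h z).1 < min (δ₀ / 2) η := fun z =>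
    (le_ciSup (f := fun z : OrbR F => rho (sigmaR F z).1 (h z).1)
      ⟨_, forall_mem_range.2 fun z => rho_le_diam _ _⟩ z).trans_lt hsup
  have hshadow : ∀ z : OrbR F, ∃ y : OrbR F, ∀ n, dist ((h^[n] z).1 0) (y.1 n) < η := by
    intro z
    obtain ⟨y, hy, hzy⟩ := hsh (fun n => (h^[n] z).1 0) fun n => by
      have hlt := hclose (h^[n] z)
      have hdist := dist_zero_le_two_mul_rho (sigmaR F (h^[n] z)).1 (h (h^[n] z)).1
      rw [Function.iterate_succ_apply']
      refine (infDist_le_dist_of_mem ((h^[n] z).2 0)).trans_lt ?_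
      rw [dist_comm]
      change dist ((h^[n] z).1 (0 + 1)) ((h (h^[n] z)).1 0) ≤ _ at hdist
      linarith [min_le_left (δ₀ / 2) η]
    exact ⟨⟨y, hy⟩, hzy⟩
  choose k hk using hshadow
  have huniq : ∀ z y : OrbR F, (∀ n, dist ((h^[n] z).1 0) (y.1 n) ≤ η) → y = k z := by
    intro z y hy
    refine hexp.eq_of_forall_dist_lt fun n => ?_
    linarith [dist_triangle_left (y.1 n) ((k z).1 n) ((h^[n] z).1 0), hy n, hk z n]
  have hcomm : ∀ z, sigmaR F (k z) = k (h z) := fun z =>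
    huniq (h z) _ fun n => (hk z (n + 1)).le
  refine ⟨k, ?_, ?_, hcomm⟩
  · have : CompactSpace (OrbR F) := isCompact_iff_compactSpace.1 (isClosed_orbR hF hFc).isCompact
    have hgraph : {p : OrbR F × OrbR F | p.2 = k p.1} =
        ⋂ n, {p | dist ((h^[n] p.1).1 0) (p.2.1 n) ≤ η} := by
      ext ⟨z, y⟩
      simp only [mem_ofPred_eq, mem_iInter]
      refine ⟨?_, huniq z y⟩
      rintro rfl n
      exact (hk z n).le
    refine continuous_of_isClosed_setOf_eq ?_
    rw [hgraph]
    refine isClosed_iInter fun n => isClosed_le ?_ continuous_const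
    have hcoord : ∀ m, Continuous fun u : OrbR F => u.1 m := fun m =>
      (continuous_apply m).comp continuous_subtype_val
    exact ((hcoord 0).comp ((hh.iterate n).comp continuous_fst)).dist
      ((hcoord n).comp continuous_snd)
  · set S := ⨆ z : OrbR F, rho (k z).1 z.1 with hS
    have hbdd : BddAbove (range fun z : OrbR F => rho (k z).1 z.1) :=
      ⟨_, forall_mem_range.2 fun z => rho_le_diam _ _⟩
    have hS0 : 0 ≤ S := Real.iSup_nonneg fun z => rho_nonneg _ _
    have hle : S ≤ (η + η) / 2 + S / 2 := by
      refine Real.iSup_le (fun z => ?_) (by positivity)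
      have hstep := rho_eq_dist_zero_add (k z).1 z.1
      have htri := rho_triangle (sigmaR F (k z)).1 (h z).1 (sigmaR F z).1
      have hlt := hclose z
      have hkh : rho (k (h z)).1 (h z).1 ≤ S := le_ciSup hbdd (h z)
      have hd := hk z 0
      rw [hcomm, rho_comm (h z).1] at htri
      rw [← hcomm] at htri hkh
      rw [Function.iterate_zero_apply, dist_comm] at hd
      change _ = _ + rho (sigmaR F (k z)).1 (sigmaR F z).1 / 2 at hstep
      linarith [min_le_right (δ₀ / 2) η]
    linarith
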